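/- Let n ≥ 3 be an integer, C > 0 a real constant, (X, μ) a measure space, and a, f, g : X → ℝ nonnegative measurable functions such that f², f^{2n/(n-2)}, aⁿ and g² are integrable. If (∫_X f^{2n/(n-2)} dμ)^{(n-2)/n} ≤ C ∫_X g² dμ and ∫_X aⁿ dμ ≤ C^{-n/2}, then 0 ≤ ∫_X g² dμ − ∫_X (a² − n) f² dμ. -/

import Mathlib

open MeasureTheory

theorem MeasureTheory.memLp_ofReal_of_integrable_rpow {X : Type*} [MeasurableSpace X]
    {μ : Measure X} {u : X → ℝ} {p : ℝ} (hp : 0 < p) (hu : AEStronglyMeasurable u μ)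
    (hu0 : ∀ x, 0 ≤ u x) (hint : Integrable (fun x => u x ^ p) μ) :
    MemLp u (ENNReal.ofReal p) μ := by
  rw [← integrable_norm_rpow_iff hu (by simpa using hp) ENNReal.ofReal_ne_top,
    ENNReal.toReal_ofReal hp.le]
  simpa only [Real.norm_of_nonneg (hu0 _)] using hint

/-- Abstract form of the full conclusion of Theorem 3.2: given the Sobolev-type
hypothesis `(∫ f^{2n/(n-2)})^{(n-2)/n} ≤ C ∫ g²` and the total-curvature bound
`∫ aⁿ ≤ C^{-n/2}`, the super stability inequality `0 ≤ ∫ g² − ∫ (a² − n) f²`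
holds. -/
theorem super_stable (n : ℕ) (hn : 3 ≤ n) (C : ℝ) (hC : 0 < C)
    {X : Type*} [MeasurableSpace X] (μ : Measure X)
    (a f g : X → ℝ) (ha : Measurable a) (hf : Measurable f) (hg : Measurable g)
    (ha0 : ∀ x, 0 ≤ a x) (hf0 : ∀ x, 0 ≤ f x) (hg0 : ∀ x, 0 ≤ g x)
    (hf2int : Integrable (fun x => f x ^ 2) μ)
    (hfint : Integrable (fun x => f x ^ ((2 * (n : ℝ)) / ((n : ℝ) - 2))) μ)
    (haint : Integrable (fun x => a x ^ n) μ)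
    (hgint : Integrable (fun x => g x ^ 2) μ)
    (hSob : (∫ x, f x ^ ((2 * (n : ℝ)) / ((n : ℝ) - 2)) ∂μ) ^ (((n : ℝ) - 2) / n) ≤
      C * ∫ x, g x ^ 2 ∂μ)
    (htot : ∫ x, a x ^ n ∂μ ≤ C ^ (-(n : ℝ) / 2)) :
    0 ≤ (∫ x, g x ^ 2 ∂μ) - ∫ x, (a x ^ 2 - (n : ℝ)) * f x ^ 2 ∂μ := by
  have hn3 : (3 : ℝ) ≤ n := by exact_mod_cast hn
  have hn0 : (0 : ℝ) < n := by linarith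
  have hn2 : (0 : ℝ) < (n : ℝ) - 2 := by linarith
  have hpq : ((n : ℝ) / 2).HolderConjugate ((n : ℝ) / ((n : ℝ) - 2)) := by
    rw [Real.holderConjugate_iff]
    refine ⟨by linarith, ?_⟩
    field_simp
    ring
  have hpow_a (x : X) : (a x ^ 2) ^ ((n : ℝ) / 2) = a x ^ n := by
    rw [← Real.rpow_natCast_mul (ha0 x), ← Real.rpow_natCast]
    congr 1
    push_cast
    ring
  have hpow_f (x : X) :
      (f x ^ 2) ^ ((n : ℝ) / ((n : ℝ) - 2)) = f x ^ ((2 * (n : ℝ)) / ((n : ℝ) - 2)) := by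
    rw [← Real.rpow_natCast_mul (hf0 x)]
    congr 1
    push_cast
    ring
  have hLa : MemLp (fun x => a x ^ 2) (ENNReal.ofReal ((n : ℝ) / 2)) μ :=
    memLp_ofReal_of_integrable_rpow hpq.pos (ha.pow_const 2).aestronglyMeasurable
      (fun x => sq_nonneg (a x)) (by simpa only [hpow_a] using haint)
  have hLf : MemLp (fun x => f x ^ 2) (ENNReal.ofReal ((n : ℝ) / ((n : ℝ) - 2))) μ :=
    memLp_ofReal_of_integrable_rpow hpq.symm.pos (hf.pow_const 2).aestronglyMeasurable
      (fun x => sq_nonneg (f x)) (by simpa only [hpow_f] using hfint)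
  have hholder := integral_mul_le_Lp_mul_Lq_of_nonneg hpq
    (.of_forall fun x => sq_nonneg (a x)) (.of_forall fun x => sq_nonneg (f x)) hLa hLf
  simp only [hpow_a, hpow_f, one_div_div] at hholder
  have hafint : Integrable (fun x => a x ^ 2 * f x ^ 2) μ :=
    haveI := hpq.ennrealOfReal
    hLa.integrable_mul hLf
  have hcurv : (∫ x, a x ^ n ∂μ) ^ (2 / (n : ℝ)) ≤ C⁻¹ := by
    calc (∫ x, a x ^ n ∂μ) ^ (2 / (n : ℝ)) ≤ (C ^ (-(n : ℝ) / 2)) ^ (2 / (n : ℝ)) :=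
          Real.rpow_le_rpow (integral_nonneg fun x => pow_nonneg (ha0 x) n) htot (by positivity)
      _ = C⁻¹ := by
          rw [← Real.rpow_mul hC.le, ← Real.rpow_neg_one]
          congr 1
          field_simp
  have hle : ∫ x, a x ^ 2 * f x ^ 2 ∂μ ≤ ∫ x, g x ^ 2 ∂μ := by
    calc ∫ x, a x ^ 2 * f x ^ 2 ∂μ ≤ C⁻¹ * (C * ∫ x, g x ^ 2 ∂μ) :=
          hholder.trans (mul_le_mul hcurv hSob
            (Real.rpow_nonneg (integral_nonneg fun x => Real.rpow_nonneg (hf0 x) _) _)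
            (by positivity))
      _ = ∫ x, g x ^ 2 ∂μ := inv_mul_cancel_left₀ hC.ne' _
  have hmono : ∫ x, (a x ^ 2 - (n : ℝ)) * f x ^ 2 ∂μ ≤ ∫ x, a x ^ 2 * f x ^ 2 ∂μ := by
    refine integral_mono ?_ hafint fun x => ?_
    · simpa only [sub_mul, Pi.sub_def] using hafint.sub (hf2int.const_mul (n : ℝ))
    · exact mul_le_mul_of_nonneg_right (by linarith) (sq_nonneg (f x))
  linarith
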